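/- Let x ∈ D ⊆ 𝒟 with E_f(x) ∈ J satisfy ‖x − T(x)‖ ⪯ γ(E_f(x))·‖W_f(x)‖, where γ : J → ℝ₊ is such that ψ(t) = 1 − b·t·γ(t) is positive on J. Then d(T(x)) ⪰ ψ(E_f(x))·d(x) ≻ 0 coordinatewise, where d(y) = (d₁(y),…,d_n(y)). (Theorem 2.1 (iv)) -/

import Mathlib

open Finset Polynomial Filter

noncomputable section

/-- The Weierstrass correction `W_i(x) = f(x_i)/(C₀ ∏_{j≠i}(x_i − x_j))`. -/
def Wc {n : ℕ} {K : Type*} [NormedField K] (f : Polynomial K) (x : Fin n → K) (i : Fin n) : K :=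
  eval (x i) f / (f.leadingCoeff * ∏ j ∈ univ.erase i, (x i - x j))

/-- `dmin x i = min_{j ≠ i} ‖x i - x j‖`. -/
def dmin {n : ℕ} {K : Type*} [NormedField K] (x : Fin n → K) (i : Fin n) : ℝ :=
  if h : (univ.erase i).Nonempty then (univ.erase i).inf' h fun j => ‖x i - x j‖ else 0

/-- `E_f(x)` : the ℓ^p norm of the vector `(‖W_i(x)‖ / d_i(x))_i`. -/
def Ef {n : ℕ} {K : Type*} [NormedField K] (p : ENNReal) (f : Polynomial K)
    (x : Fin n → K) : ℝ :=
  ‖(WithLp.equiv p (Fin n → ℝ)).symm (fun i => ‖Wc f x i‖ / dmin x i)‖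

/-- `σ_i(x) = Σ_{j≠i} W_j(x)/(x_i − x_j)`. -/
def sigmaf {n : ℕ} {K : Type*} [NormedField K] (f : Polynomial K) (x : Fin n → K)
    (i : Fin n) : K :=
  ∑ j ∈ univ.erase i, Wc f x j / (x i - x j)

/-- The Ehrlich iteration function. -/
def PhiE {n : ℕ} {K : Type*} [NormedField K] (f : Polynomial K) (x : Fin n → K) : Fin n → K :=
  fun i => x i - Wc f x i / (1 + sigmaf f x i)

/-- The Prešić–Tanabe iteration function. -/
def TnbE {n : ℕ} {K : Type*} [NormedField K] (f : Polynomial K) (x : Fin n → K) : Fin n → K :=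
  fun i => x i - Wc f x i * (1 - sigmaf f x i)

/-- `ξ` is a root vector of `f`, i.e. `f(z) = C₀ ∏ (z − ξᵢ)`. -/
def IsRootVector {n : ℕ} {K : Type*} [NormedField K] (f : Polynomial K) (ξ : Fin n → K) : Prop :=
  f = C f.leadingCoeff * ∏ i, (X - C (ξ i))

/-- `E_f(x)` in the case `p = ∞`: the max of `‖W_i(x)‖ / d_i(x)`. -/
def Einf {n : ℕ} {K : Type*} [NormedField K] (f : Polynomial K) (x : Fin n → K) : ℝ :=
  if h : (univ : Finset (Fin n)).Nonempty then univ.sup' h fun i => ‖Wc f x i‖ / dmin x i else 0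

/-- The two-term Hölder inequality for the `ℓ^p` norm of a nonnegative vector. -/
theorem PiLp.add_le_two_rpow_mul_norm {ι : Type*} [Fintype ι] (p q : ENNReal) (hp : 1 ≤ p)
    (hpq : p⁻¹ + q⁻¹ = 1) (u : ι → ℝ) (hu : ∀ i, 0 ≤ u i) {i j : ι} (hij : i ≠ j) :
    u i + u j ≤ (2 : ℝ) ^ q⁻¹.toReal * ‖(WithLp.equiv p (ι → ℝ)).symm u‖ := by
  classical
  have : Fact (1 ≤ p) := ⟨hp⟩
  rcases eq_or_ne p ⊤ with rfl | hptop
  · have hq : q⁻¹ = 1 := by simpa using hpq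
    have hi := PiLp.norm_apply_le ((WithLp.equiv ⊤ (ι → ℝ)).symm u) i
    have hj := PiLp.norm_apply_le ((WithLp.equiv ⊤ (ι → ℝ)).symm u) j
    have hi' := (le_abs_self (u i)).trans hi
    have hj' := (le_abs_self (u j)).trans hj
    rw [hq, ENNReal.toReal_one, Real.rpow_one]
    linarith
  · have hp1 : 1 ≤ p.toReal := by
      simpa using ENNReal.toReal_mono hptop hp
    have hp0 : 0 < p.toReal := by linarith
    have hpinv : p⁻¹ ≠ ⊤ := fun h => by simp [h] at hpq
    have hqinv : q⁻¹ ≠ ⊤ := fun h => by simp [h] at hpq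
    have hsum : p.toReal⁻¹ + q⁻¹.toReal = 1 := by
      rw [← ENNReal.toReal_inv, ← ENNReal.toReal_add hpinv hqinv, hpq, ENNReal.toReal_one]
    have hnorm : ‖(WithLp.equiv p (ι → ℝ)).symm u‖ ^ p.toReal = ∑ k, u k ^ p.toReal := by
      rw [PiLp.norm_eq_sum hp0, ← Real.rpow_mul (by positivity), one_div,
        inv_mul_cancel₀ hp0.ne', Real.rpow_one]
      refine Finset.sum_congr rfl fun k _ => ?_
      rw [show ‖((WithLp.equiv p (ι → ℝ)).symm u) k‖ = u k from
        Real.norm_of_nonneg (hu k)]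
    have hpair : u i ^ p.toReal + u j ^ p.toReal ≤ ∑ k, u k ^ p.toReal := by
      rw [← Finset.sum_pair (f := fun k => u k ^ p.toReal) hij]
      exact Finset.sum_le_sum_of_subset_of_nonneg (Finset.subset_univ _)
        fun k _ _ => Real.rpow_nonneg (hu k) _
    have hexp : q⁻¹.toReal * p.toReal = p.toReal - 1 := by
      field_simp at hsum
      linarith
    rw [← Real.rpow_le_rpow_iff (add_nonneg (hu i) (hu j)) (by positivity) hp0,
      Real.mul_rpow (by positivity) (norm_nonneg _), ← Real.rpow_mul (by norm_num), hexp, hnorm]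
    calc (u i + u j) ^ p.toReal
        ≤ 2 ^ (p.toReal - 1) * (u i ^ p.toReal + u j ^ p.toReal) :=
          mod_cast NNReal.rpow_add_le_mul_rpow_add_rpow ⟨u i, hu i⟩ ⟨u j, hu j⟩ hp1
      _ ≤ _ := by gcongr

theorem dmin_le {n : ℕ} {K : Type*} [NormedField K] (x : Fin n → K) {i j : Fin n} (hij : j ≠ i) :
    dmin x i ≤ ‖x i - x j‖ := by
  have hj : j ∈ univ.erase i := by simp [hij]
  rw [dmin, dif_pos ⟨j, hj⟩]
  exact Finset.inf'_le _ hj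

theorem exists_dmin_eq {n : ℕ} {K : Type*} [NormedField K] (hn : 2 ≤ n) (x : Fin n → K)
    (i : Fin n) : ∃ j, j ≠ i ∧ dmin x i = ‖x i - x j‖ := by
  have : Nontrivial (Fin n) := Fin.nontrivial_iff_two_le.mpr hn
  obtain ⟨k, hk⟩ := exists_ne i
  have h : (univ.erase i).Nonempty := ⟨k, by simp [hk]⟩
  obtain ⟨j, hj, hji⟩ := Finset.exists_mem_eq_inf' h fun j => ‖x i - x j‖
  refine ⟨j, Finset.ne_of_mem_erase hj, ?_⟩
  rw [dmin, dif_pos h, hji]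

theorem dmin_pos {n : ℕ} {K : Type*} [NormedField K] (hn : 2 ≤ n) {x : Fin n → K}
    (hx : Function.Injective x) (i : Fin n) : 0 < dmin x i := by
  obtain ⟨j, hj, h⟩ := exists_dmin_eq hn x i
  rw [h]
  exact norm_pos_iff.mpr (sub_ne_zero.mpr (hx.ne hj.symm))

/-- Proinov, Theorem 2.1 (iv). -/
theorem stmt_2 {n : ℕ} {K : Type*} [NormedField K] [CompleteSpace K] (hn : 2 ≤ n)
    (f : Polynomial K) (hdeg : f.degree = (n : ℕ))
    (p q : ENNReal) (hp : 1 ≤ p) (hpq : p⁻¹ + q⁻¹ = 1)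
    (b : ℝ) (hb : b = (2 : ℝ) ^ (ENNReal.toReal q⁻¹))
    (J : Set ℝ) (hJ0 : (0 : ℝ) ∈ J) (hJsub : J ⊆ Set.Ici (0 : ℝ)) (hJconn : J.OrdConnected)
    (γ : ℝ → ℝ) (hγ : ∀ t ∈ J, 0 ≤ γ t) (hψ : ∀ t ∈ J, 0 < 1 - b * t * γ t)
    (D : Set (Fin n → K)) (hD : ∀ y ∈ D, Function.Injective y)
    (T : (Fin n → K) → Fin n → K)
    (x : Fin n → K) (hxD : x ∈ D) (hxE : Ef p f x ∈ J)
    (hmain : ∀ i, ‖x i - T x i‖ ≤ γ (Ef p f x) * ‖Wc f x i‖) :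
    ∀ i : Fin n,
      0 < (1 - b * Ef p f x * γ (Ef p f x)) * dmin x i ∧
      (1 - b * Ef p f x * γ (Ef p f x)) * dmin x i ≤ dmin (T x) i := by
  have hd := dmin_pos hn (hD x hxD)
  set E := Ef p f x with hE
  have hψE := hψ E hxE
  have hγE := hγ E hxE
  intro i
  refine ⟨mul_pos hψE (hd i), ?_⟩
  obtain ⟨j, hj, hTj⟩ := exists_dmin_eq hn (T x) i
  have hW : ∀ k, ‖x i - x j‖ ≥ dmin x k →
      ‖Wc f x k‖ ≤ ‖Wc f x k‖ / dmin x k * ‖x i - x j‖ := fun k hk => by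
    have := hd k
    calc ‖Wc f x k‖ = ‖Wc f x k‖ / dmin x k * dmin x k := by field_simp
      _ ≤ _ := by gcongr
  have hWi := hW i (dmin_le x hj)
  have hWj := hW j (norm_sub_rev (x i) (x j) ▸ dmin_le x hj.symm)
  have hsum : ‖Wc f x i‖ / dmin x i + ‖Wc f x j‖ / dmin x j ≤ b * E := by
    rw [hb]
    exact PiLp.add_le_two_rpow_mul_norm p q hp hpq (fun k => ‖Wc f x k‖ / dmin x k)
      (fun k => div_nonneg (norm_nonneg _) (hd k).le) hj.symm
  have htri : ‖x i - x j‖ ≤ ‖x i - T x i‖ + ‖T x i - T x j‖ + ‖x j - T x j‖ := by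
    rw [norm_sub_rev (x j)]
    refine le_trans (le_of_eq ?_) norm_add₃_le
    congr 1
    ring
  have hWsum : ‖Wc f x i‖ + ‖Wc f x j‖ ≤ b * E * ‖x i - x j‖ := by
    have := mul_le_mul_of_nonneg_right hsum (norm_nonneg (x i - x j))
    linarith
  have hcorr := mul_le_mul_of_nonneg_left hWsum hγE
  rw [hTj]
  calc (1 - b * E * γ E) * dmin x i ≤ (1 - b * E * γ E) * ‖x i - x j‖ :=
        mul_le_mul_of_nonneg_left (dmin_le x hj) hψE.le
    _ ≤ ‖T x i - T x j‖ := by linarith [hmain i, hmain j]
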